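/- Let d ≥ 2, k ∈ ℕ, θ ∈ (0,1], L ≥ 0 and R ≥ 0. There exists a constant C > 0, depending only on d, k, θ, L and R, such that for every h > 0, all axis-aligned cubes K, K' ⊆ ℝ^d of side h with dist(K, K') ≤ R·h, every Lebesgue-measurable set S ⊆ K' with λ(S) ≥ θ·h^d, every L-Lipschitz function f : ℝ^{d−1} → ℝ, and every polynomial p of coordinatewise degree at most k+1, one has h·∫_{Γ_f ∩ K} |∇p|² dμH^{d−1} ≤ C·∫_S |∇p|² dλ, where ∇p denotes the gradient of p and |·| the Euclidean norm on ℝ^d. -/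

import Mathlib

open MeasureTheory

namespace MvPolynomial

/-- The real zero set of a nonzero polynomial is Lebesgue-null. -/
theorem volume_setOf_eval_eq_zero {n : ℕ} {p : MvPolynomial (Fin n) ℝ} (hp : p ≠ 0) :
    volume {x : Fin n → ℝ | eval x p = 0} = 0 := by
  induction n with
  | zero =>
    have : {x : Fin 0 → ℝ | eval x p = 0} = ∅ := by
      refine Set.eq_empty_of_forall_notMem fun x hx => hp (MvPolynomial.funext fun y => ?_)
      rw [Subsingleton.elim y x]
      simpa using hx
    rw [this, measure_empty]
  | succ n ih =>
    have hq : finSuccEquiv ℝ n p ≠ 0 := by simpa using hp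
    have hlead := ih (Polynomial.leadingCoeff_ne_zero.mpr hq)
    have hmeas : MeasurableSet {x : Fin (n + 1) → ℝ | eval x p = 0} :=
      ((MvPolynomial.continuous_eval p).measurable) (measurableSet_singleton 0)
    have e := (volume_preserving_piFinSuccAbove (fun _ : Fin (n + 1) => ℝ) 0).symm.comp
      (Measure.measurePreserving_swap (μ := (volume : Measure (Fin n → ℝ)))
        (ν := (volume : Measure ℝ)))
    rw [← e.measure_preimage hmeas.nullMeasurableSet, Measure.measure_prod_null (e.measurable hmeas)]
    filter_upwards [measure_eq_zero_iff_ae_notMem.mp hlead] with x hx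
    have hx0 : Polynomial.map (eval x) (finSuccEquiv ℝ n p) ≠ 0 := by
      intro h0
      apply hx
      have := congrArg (fun r => Polynomial.coeff r (finSuccEquiv ℝ n p).natDegree) h0
      simpa [Polynomial.coeff_map] using this
    refine (Set.Finite.subset
      (Polynomial.map (eval x) (finSuccEquiv ℝ n p)).roots.toFinset.finite_toSet fun y hy => ?_).measure_zero _
    have hy' : eval (Fin.cons y x : Fin (n + 1) → ℝ) p = 0 := by
      simpa [MeasurableEquiv.piFinSuccAbove, Fin.insertNthEquiv] using hy
    rw [eval_eq_eval_mv_eval'] at hy'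
    simpa [hx0] using hy'

theorem totalDegree_pderiv_le {σ : Type*} (i : σ) (p : MvPolynomial σ ℝ) :
    (pderiv i p).totalDegree ≤ p.totalDegree := by
  classical
  conv_lhs => rw [p.as_sum, map_sum]
  refine totalDegree_finsetSum_le fun s hs => ?_
  rw [pderiv_monomial]
  refine (totalDegree_monomial_le _ _).trans (le_trans ?_ (le_totalDegree hs))
  exact Finsupp.degree_mono tsub_le_self

theorem totalDegree_bind₁_le {σ τ : Type*} (f : σ → MvPolynomial τ ℝ)
    (hf : ∀ i, (f i).totalDegree ≤ 1) (p : MvPolynomial σ ℝ) :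
    (bind₁ f p).totalDegree ≤ p.totalDegree := by
  conv_lhs => rw [p.as_sum, map_sum]
  refine totalDegree_finsetSum_le fun s hs => ?_
  rw [bind₁_monomial]
  refine (totalDegree_mul _ _).trans (le_trans ?_ (le_totalDegree hs))
  rw [totalDegree_C, zero_add]
  refine (totalDegree_finsetProd _ _).trans (Finset.sum_le_sum fun i _ => ?_)
  exact (totalDegree_pow _ _).trans (by simpa using Nat.mul_le_mul_left (s i) (hf i))

theorem totalDegree_le_sum_degreeOf {σ : Type*} [Fintype σ] (p : MvPolynomial σ ℝ) :
    p.totalDegree ≤ ∑ i, p.degreeOf i := by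
  refine Finset.sup_le fun s hs => ?_
  rw [Finsupp.sum_fintype _ _ (fun _ => rfl)]
  exact Finset.sum_le_sum fun i _ => monomial_le_degreeOf i hs

end MvPolynomial

/-- On the unit cube, a polynomial of bounded degree is small compared with its values on a
larger cube only on a set of small measure. -/
theorem exists_volume_abs_eval_lt_le (n N : ℕ) {M δ : ℝ} (hM : 1 ≤ M) (hδ : 0 < δ) :
    ∃ ε : ℝ, 0 < ε ∧ ∀ q : MvPolynomial (Fin n) ℝ, q.totalDegree ≤ N →
      ∀ x ∈ Set.Icc (fun _ : Fin n => -M) (fun _ => M),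
        volume {z : Fin n → ℝ | z ∈ Set.Icc 0 1 ∧ |q.eval z| < ε * |q.eval x|}
          ≤ ENNReal.ofReal δ := by
  let Q : Set (Fin n → ℝ) := Set.Icc (fun _ : Fin n => -M) (fun _ => M)
  have hQ : Set.Icc (0 : Fin n → ℝ) 1 ⊆ Q :=
    Set.Icc_subset_Icc (fun i => by simp; linarith) (fun i => by simpa using hM)
  have : CompactSpace Q := isCompact_iff_compactSpace.mp isCompact_Icc
  let T : MvPolynomial (Fin n) ℝ →ₗ[ℝ] C(Q, ℝ) :=
    { toFun := fun q => ⟨fun z => q.eval z.1,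
        (MvPolynomial.continuous_eval q).comp continuous_subtype_val⟩
      map_add' := fun p q => by ext; simp
      map_smul' := fun c q => by ext; simp }
  let V : Submodule ℝ C(Q, ℝ) := (MvPolynomial.restrictTotalDegree (Fin n) ℝ N).map T
  have hcpt : IsCompact ((Subtype.val : V → C(Q, ℝ)) '' Metric.sphere (0 : V) 1) := by
    have : ProperSpace V := FiniteDimensional.proper ℝ V
    exact (isCompact_sphere 0 1).image continuous_subtype_val
  have key : ∃ ε : ℝ, 0 < ε ∧ ∀ q,
      T q ∈ (Subtype.val : V → C(Q, ℝ)) '' Metric.sphere (0 : V) 1 →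
      volume {z : Fin n → ℝ | z ∈ Set.Icc 0 1 ∧ |q.eval z| < ε} ≤ ENNReal.ofReal δ := by
    refine hcpt.induction_on (p := fun s => ∃ ε : ℝ, 0 < ε ∧ ∀ q, T q ∈ s →
      volume {z : Fin n → ℝ | z ∈ Set.Icc 0 1 ∧ |q.eval z| < ε} ≤ ENNReal.ofReal δ) ?_ ?_ ?_ ?_
    · exact ⟨1, one_pos, fun q hq => hq.elim⟩
    · rintro s t hst ⟨ε, hε, H⟩
      exact ⟨ε, hε, fun q hq => H q (hst hq)⟩
    · rintro s t ⟨ε, hε, H⟩ ⟨ε', hε', H'⟩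
      refine ⟨min ε ε', lt_min hε hε', ?_⟩
      rintro q (hq | hq)
      · exact le_trans (measure_mono fun z hz =>
          And.imp_right (fun h => h.trans_le (min_le_left _ _)) hz) (H q hq)
      · exact le_trans (measure_mono fun z hz =>
          And.imp_right (fun h => h.trans_le (min_le_right _ _)) hz) (H' q hq)
    · rintro _ ⟨⟨_, q₀, hq₀, rfl⟩, hw, rfl⟩
      have hq₀0 : q₀ ≠ 0 := by
        rintro rfl
        simp at hw
      have hanti : Antitone fun m : ℕ =>
          {z : Fin n → ℝ | z ∈ Set.Icc 0 1 ∧ |q₀.eval z| ≤ 1 / ((m : ℝ) + 1)} :=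
        fun a b hab z hz => ⟨hz.1, hz.2.trans (Nat.one_div_le_one_div hab)⟩
      have hlim := tendsto_measure_iInter_atTop (μ := (volume : Measure (Fin n → ℝ)))
        (s := fun m : ℕ => {z : Fin n → ℝ | z ∈ Set.Icc 0 1 ∧ |q₀.eval z| ≤ 1 / ((m : ℝ) + 1)})
        (fun m => (measurableSet_Icc.inter (measurableSet_le
          (MvPolynomial.continuous_eval q₀).abs.measurable measurable_const)).nullMeasurableSet)
        hanti ⟨0, ((measure_mono fun z hz => hz.1).trans_lt
          (isCompact_Icc (a := (0 : Fin n → ℝ)) (b := 1)).measure_lt_top).ne⟩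
      have hnull : volume (⋂ m : ℕ, {z : Fin n → ℝ | z ∈ Set.Icc 0 1 ∧
          |q₀.eval z| ≤ 1 / ((m : ℝ) + 1)}) = 0 := by
        refine measure_mono_null (fun z hz => ?_) (MvPolynomial.volume_setOf_eval_eq_zero hq₀0)
        rw [Set.mem_iInter] at hz
        refine abs_nonpos_iff.mp (ge_of_tendsto' tendsto_one_div_add_atTop_nhds_zero_nat
          fun m => (hz m).2)
      rw [hnull] at hlim
      obtain ⟨m, hm⟩ := (hlim.eventually_lt_const (ENNReal.ofReal_pos.mpr hδ)).exists
      have hpos : (0 : ℝ) < 1 / ((m : ℝ) + 1) / 2 := by positivity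
      refine ⟨Metric.ball (T q₀) (1 / ((m : ℝ) + 1) / 2),
        mem_nhdsWithin_of_mem_nhds (Metric.ball_mem_nhds _ hpos), _, hpos, fun q hq => ?_⟩
      refine le_trans (measure_mono ?_) hm.le
      refine fun z hz => ⟨hz.1, ?_⟩
      have h1 : |q.eval z - q₀.eval z| < 1 / ((m : ℝ) + 1) / 2 :=
        (ContinuousMap.dist_apply_le_dist (f := T q) (g := T q₀) ⟨z, hQ hz.1⟩).trans_lt hq
      have h2 := hz.2
      rw [abs_lt] at h1 h2
      rw [abs_le]
      constructor <;> linarith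
  obtain ⟨ε, hε, H⟩ := key
  refine ⟨ε, hε, fun q hq x hx => ?_⟩
  have hxn : |q.eval x| ≤ ‖T q‖ := (T q).norm_coe_le_norm ⟨x, hx⟩
  rcases (norm_nonneg (T q)).eq_or_lt with h0 | hpos
  · have : |q.eval x| = 0 := le_antisymm (h0 ▸ hxn) (abs_nonneg _)
    simp only [this, mul_zero, (abs_nonneg _).not_gt, and_false, Set.ofPred_false, measure_empty,
      zero_le]
  · have hmem : ‖T q‖⁻¹ • q ∈ MvPolynomial.restrictTotalDegree (Fin n) ℝ N :=
      Submodule.smul_mem _ _ ((MvPolynomial.mem_restrictTotalDegree _ _ _).mpr hq)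
    refine le_trans (measure_mono ?_) (H (‖T q‖⁻¹ • q)
      ⟨⟨T (‖T q‖⁻¹ • q), Submodule.mem_map_of_mem hmem⟩, ?_, rfl⟩)
    · refine fun z hz => ⟨hz.1, ?_⟩
      rw [MvPolynomial.smul_eval, abs_mul, abs_inv, abs_norm, inv_mul_lt_iff₀ hpos, mul_comm]
      exact hz.2.trans_le (mul_le_mul_of_nonneg_left hxn hε.le)
    · rw [mem_sphere_zero_iff_norm]
      change ‖T (‖T q‖⁻¹ • q)‖ = 1
      rw [map_smul, norm_smul, norm_inv, norm_norm,
        inv_mul_cancel₀ hpos.ne']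

/-- Affinely rescaled form of `exists_volume_abs_eval_lt_le`, uniform in the cube. -/
theorem exists_volume_abs_eval_lt_le_scaled (n N : ℕ) {M δ : ℝ} (hM : 1 ≤ M) (hδ : 0 < δ) :
    ∃ ε : ℝ, 0 < ε ∧ ∀ q : MvPolynomial (Fin n) ℝ, q.totalDegree ≤ N →
      ∀ h : ℝ, 0 < h → ∀ b x : Fin n → ℝ, (∀ i, |x i - b i| ≤ M * h) →
        volume {y : Fin n → ℝ | (∀ i, y i ∈ Set.Icc (b i) (b i + h)) ∧
            |q.eval y| < ε * |q.eval x|} ≤ ENNReal.ofReal (δ * h ^ n) := by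
  obtain ⟨ε, hε, H⟩ := exists_volume_abs_eval_lt_le n N hM hδ
  refine ⟨ε, hε, fun q hq h hh b x hx => ?_⟩
  set q' := MvPolynomial.bind₁ (fun i => MvPolynomial.C (b i) + MvPolynomial.C h * MvPolynomial.X i) q
    with hq'
  have hdeg : q'.totalDegree ≤ N := by
    refine (MvPolynomial.totalDegree_bind₁_le _ (fun i => ?_) q).trans hq
    refine (MvPolynomial.totalDegree_add _ _).trans (max_le (by simp) ?_)
    exact (MvPolynomial.totalDegree_mul _ _).trans (by simp)
  have heval : ∀ y : Fin n → ℝ, q'.eval (h⁻¹ • (y + -b)) = q.eval y := by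
    intro y
    rw [hq', ← MvPolynomial.coe_aeval_eq_eval, ← MvPolynomial.coe_aeval_eq_eval]
    simp only [RingHom.coe_coe, MvPolynomial.aeval_bind₁]
    congr 2
    ext i
    simp
    field_simp
    ring
  have hset : {y : Fin n → ℝ | (∀ i, y i ∈ Set.Icc (b i) (b i + h)) ∧
      |q.eval y| < ε * |q.eval x|} = (fun y => y + -b) ⁻¹' ((fun z => h⁻¹ • z) ⁻¹'
      {z : Fin n → ℝ | z ∈ Set.Icc 0 1 ∧ |q'.eval z| < ε * |q'.eval (h⁻¹ • (x + -b))|}) := by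
    ext y
    simp only [Set.mem_preimage, Set.mem_ofPred_eq, heval]
    refine and_congr_left fun _ => ?_
    simp only [Set.mem_Icc, Pi.le_def, ← forall_and]
    refine forall_congr' fun i => ?_
    simp only [Pi.zero_apply, Pi.one_apply, Pi.smul_apply, Pi.add_apply, Pi.neg_apply, smul_eq_mul]
    rw [inv_mul_le_iff₀ hh, mul_nonneg_iff_of_pos_left (inv_pos.mpr hh)]
    constructor <;> rintro ⟨h1, h2⟩ <;> constructor <;> linarith
  rw [hset, measure_preimage_add_right, Measure.addHaar_preimage_smul _ (inv_ne_zero hh.ne')]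
  rw [inv_pow, inv_inv, Module.finrank_fin_fun, abs_of_pos (by positivity), mul_comm δ,
    ENNReal.ofReal_mul (by positivity)]
  gcongr
  refine H q' hdeg _ ?_
  rw [Set.mem_Icc, Pi.le_def, Pi.le_def, ← forall_and]
  intro i
  have := abs_le.mp (hx i)
  simp only [Pi.smul_apply, Pi.add_apply, Pi.neg_apply, smul_eq_mul]
  rw [inv_mul_le_iff₀ hh, ← div_eq_inv_mul, le_div_iff₀ hh]
  constructor <;> linarith

/-- Axis-aligned cubes in Euclidean space are compact. -/
theorem isCompact_euclidean_box {n : ℕ} (b : EuclideanSpace ℝ (Fin n)) (h : ℝ) :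
    IsCompact {y : EuclideanSpace ℝ (Fin n) | ∀ i, y i ∈ Set.Icc (b i) (b i + h)} := by
  convert (isCompact_Icc (a := fun i => b i) (b := fun i => b i + h)).image
    (PiLp.continuous_toLp 2 fun _ : Fin n => ℝ) using 1
  ext y
  constructor
  · exact fun hy => ⟨fun i => y i, ⟨fun i => (hy i).1, fun i => (hy i).2⟩, rfl⟩
  · rintro ⟨x, hx, rfl⟩
    exact fun i => ⟨hx.1 i, hx.2 i⟩

theorem integrableOn_sq_eval {n : ℕ} (q : MvPolynomial (Fin n) ℝ)
    {b : EuclideanSpace ℝ (Fin n)} {h : ℝ} {S : Set (EuclideanSpace ℝ (Fin n))}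
    (hS : S ⊆ {y | ∀ i, y i ∈ Set.Icc (b i) (b i + h)}) :
    IntegrableOn (fun y : EuclideanSpace ℝ (Fin n) => (q.eval (fun i => y i)) ^ 2) S := by
  have hcont : Continuous fun y : EuclideanSpace ℝ (Fin n) => q.eval (fun i => y i) :=
    (MvPolynomial.continuous_eval q).comp (by fun_prop)
  exact ((hcont.pow 2).continuousOn.integrableOn_compact (isCompact_euclidean_box b h)).mono_set hS

/-- Remez-type inequality: point values of a polynomial near a cube are controlled by its
`L²`-norm on any subset of the cube of relative measure at least `θ`. -/
theorem exists_sq_eval_le_setIntegral (n N : ℕ) {M θ : ℝ} (hM : 1 ≤ M) (hθ : 0 < θ) :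
    ∃ c : ℝ, 0 < c ∧ ∀ q : MvPolynomial (Fin n) ℝ, q.totalDegree ≤ N →
      ∀ h : ℝ, 0 < h → ∀ b x : EuclideanSpace ℝ (Fin n), (∀ i, |x i - b i| ≤ M * h) →
        ∀ S : Set (EuclideanSpace ℝ (Fin n)), MeasurableSet S →
          S ⊆ {y | ∀ i, y i ∈ Set.Icc (b i) (b i + h)} →
          ENNReal.ofReal (θ * h ^ n) ≤ volume S →
          c * h ^ n * (q.eval (fun i => x i)) ^ 2
            ≤ ∫ y in S, (q.eval (fun i => y i)) ^ 2 := by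
  obtain ⟨ε, hε, H⟩ := exists_volume_abs_eval_lt_le_scaled n N hM (half_pos hθ)
  refine ⟨θ / 2 * ε ^ 2, by positivity, fun q hq h hh b x hx S hS hSb hSθ => ?_⟩
  set s := (ε * |q.eval (fun i => x i)|) ^ 2 with hs
  have hcont : Continuous fun y : EuclideanSpace ℝ (Fin n) => q.eval (fun i => y i) :=
    (MvPolynomial.continuous_eval q).comp (by fun_prop)
  have hmarkov := mul_meas_ge_le_integral_of_nonneg (μ := volume.restrict S)
    (Filter.Eventually.of_forall fun y : EuclideanSpace ℝ (Fin n) =>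
      sq_nonneg (q.eval (fun i => y i)))
    (integrableOn_sq_eval q hSb) s
  have hmeas : MeasurableSet {y : EuclideanSpace ℝ (Fin n) | s ≤ (q.eval (fun i => y i)) ^ 2} :=
    measurableSet_le measurable_const (hcont.pow 2).measurable
  have hiff : ∀ y : Fin n → ℝ, (q.eval y) ^ 2 < s ↔ |q.eval y| < ε * |q.eval (fun i => x i)| := by
    intro y
    rw [hs, sq_lt_sq, abs_of_nonneg (a := ε * _) (by positivity)]
  have hsmall : volume (S \ {y : EuclideanSpace ℝ (Fin n) | s ≤ (q.eval (fun i => y i)) ^ 2})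
      ≤ ENNReal.ofReal (θ / 2 * h ^ n) := by
    have hB := H q hq h hh (fun i => b i) (fun i => x i) hx
    set B := {y : Fin n → ℝ | (∀ i, y i ∈ Set.Icc (b i) (b i + h)) ∧
            |q.eval y| < ε * |q.eval (fun i => x i)|} with hBdef
    have hBm : MeasurableSet B := by
      refine MeasurableSet.inter
        (?_ : MeasurableSet {y : Fin n → ℝ | ∀ i, y i ∈ Set.Icc (b i) (b i + h)})
        (measurableSet_lt (MvPolynomial.continuous_eval q).abs.measurable measurable_const)
      have : {y : Fin n → ℝ | ∀ i, y i ∈ Set.Icc (b i) (b i + h)} =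
          Set.Icc (fun i => b i) (fun i => b i + h) := by
        ext y
        simp [Pi.le_def, forall_and]
      exact this ▸ measurableSet_Icc
    rw [← (PiLp.volume_preserving_ofLp (Fin n)).measure_preimage hBm.nullMeasurableSet] at hB
    refine (measure_mono fun y hy => ?_).trans hB
    exact ⟨hSb hy.1, (hiff _).mp (not_le.mp hy.2)⟩
  have hlarge : θ / 2 * h ^ n ≤ (volume.restrict S).real
      {y : EuclideanSpace ℝ (Fin n) | s ≤ (q.eval (fun i => y i)) ^ 2} := by
    have hfin : volume S ≠ ⊤ :=
      ((measure_mono hSb).trans_lt (isCompact_euclidean_box _ h).measure_lt_top).ne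
    rw [measureReal_restrict_apply hmeas, Set.inter_comm, measureReal_def]
    refine (ENNReal.ofReal_le_iff_le_toReal (measure_ne_top_of_subset Set.inter_subset_left hfin)).mp ?_
    have hsplit := measure_inter_add_sdiff (μ := volume) S hmeas
    have : ENNReal.ofReal (θ / 2 * h ^ n) + ENNReal.ofReal (θ / 2 * h ^ n) ≤
        volume (S ∩ {y | s ≤ (q.eval (fun i => y i)) ^ 2}) + ENNReal.ofReal (θ / 2 * h ^ n) := by
      rw [← ENNReal.ofReal_add (by positivity) (by positivity)]
      calc _ = ENNReal.ofReal (θ * h ^ n) := by ring_nf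
        _ ≤ _ := hSθ
        _ ≤ _ := by rw [← hsplit]; gcongr
    exact (ENNReal.add_le_add_iff_right ENNReal.ofReal_ne_top).mp this
  calc _ = s * (θ / 2 * h ^ n) := by rw [hs, mul_pow, sq_abs]; ring
    _ ≤ _ := (mul_le_mul_of_nonneg_left hlarge (sq_nonneg _)).trans hmarkov

/-- A box-truncated Lipschitz graph has `(d-1)`-dimensional Hausdorff measure at most
a constant times the corresponding power of the side length. -/
theorem exists_hausdorffMeasure_lipschitz_graph_le (m : ℕ) {L : ℝ} (hL : 0 ≤ L) :
    ∃ c : ℝ, 0 < c ∧ ∀ h : ℝ, 0 < h → ∀ a : EuclideanSpace ℝ (Fin (m + 1)),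
      ∀ f : EuclideanSpace ℝ (Fin m) → ℝ, (∀ x y, |f x - f y| ≤ L * dist x y) →
        μH[(m : ℝ)] ({y : EuclideanSpace ℝ (Fin (m + 1)) |
            ∃ x : EuclideanSpace ℝ (Fin m), (∀ i : Fin m, y (Fin.castSucc i) = x i) ∧
              y (Fin.last m) = f x} ∩ {y | ∀ i, y i ∈ Set.Icc (a i) (a i + h)})
          ≤ ENNReal.ofReal (c * h ^ m) := by
  obtain ⟨A, hA⟩ : ∃ A : NNReal, LipschitzWith A
      (WithLp.toLp 2 : (Fin m → ℝ) → EuclideanSpace ℝ (Fin m)) :=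
    ⟨_, PiLp.lipschitzWith_toLp 2 _⟩
  obtain ⟨B, hB⟩ : ∃ B : NNReal, LipschitzWith B
      (WithLp.toLp 2 : (Fin (m + 1) → ℝ) → EuclideanSpace ℝ (Fin (m + 1))) :=
    ⟨_, PiLp.lipschitzWith_toLp 2 _⟩
  refine ⟨((B * max 1 (L.toNNReal * A) : NNReal) : ℝ) ^ m + 1, by positivity,
    fun h hh a f hf => ?_⟩
  have hfL : LipschitzWith L.toNNReal f := LipschitzWith.of_dist_le_mul fun x y => by
    rw [Real.coe_toNNReal _ hL]; exact hf x y
  set g : (Fin m → ℝ) → EuclideanSpace ℝ (Fin (m + 1)) :=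
    fun x => WithLp.toLp 2 (Fin.snoc (α := fun _ => ℝ) x (f (WithLp.toLp 2 x))) with hg
  have hgL : LipschitzWith (B * max 1 (L.toNNReal * A)) g := by
    refine hB.comp (f := WithLp.toLp 2)
      (g := fun x => Fin.snoc (α := fun _ => ℝ) x (f (WithLp.toLp 2 x))) ?_
    refine LipschitzWith.of_dist_le_mul fun x y => (dist_pi_le_iff (by positivity)).mpr fun i => ?_
    refine Fin.lastCases ?_ (fun j => ?_) i
    · simpa using ((hfL.comp hA).weaken (le_max_right 1 _)).dist_le_mul x y
    · simpa using ((LipschitzWith.eval (α := fun _ : Fin m => ℝ) j).weaken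
        (le_max_left 1 (L.toNNReal * A))).dist_le_mul x y
  set I := Set.Icc (fun i : Fin m => a (Fin.castSucc i)) (fun i => a (Fin.castSucc i) + h) with hI
  have hI' : μH[(m : ℝ)] I = ENNReal.ofReal (h ^ m) := by
    have := congrArg (fun μ => μ I) (hausdorffMeasure_pi_real (ι := Fin m))
    simp only [Fintype.card_fin] at this
    rw [this, hI, Real.volume_Icc_pi]
    simp [ENNReal.ofReal_pow hh.le]
  calc _ ≤ μH[(m : ℝ)] (g '' I) := by
        refine measure_mono ?_
        rintro y ⟨⟨x, hx, hfx⟩, hy⟩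
        refine ⟨fun i => x i, ⟨fun i => ?_, fun i => ?_⟩, ?_⟩
        · exact (hy _).1.trans_eq (hx i)
        · exact (hx i).symm.trans_le (hy _).2
        · ext i
          refine Fin.lastCases ?_ (fun j => ?_) i
          · simp [hg, hfx]
          · simp [hg, hx]
    _ ≤ _ := hgL.hausdorffMeasure_image_le (Nat.cast_nonneg m) I
    _ ≤ _ := by
        rw [hI', ENNReal.ofReal_mul (by positivity), ENNReal.rpow_natCast]
        gcongr
        rw [← ENNReal.ofReal_coe_nnreal, ← ENNReal.ofReal_pow (by positivity)]
        exact ENNReal.ofReal_le_ofReal (by linarith)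

/-- weighted trace stability for gradients: if `K, K'` are axis-aligned cubes of
side `h` at distance at most `R·h`, `S ⊆ K'` has measure at least `θ·h^d`, and `Γ_f` is a
Lipschitz graph, then the `h`-weighted interface `L²`-norm over `Γ_f ∩ K` of the gradient of
any polynomial of coordinatewise degree at most `k+1` is controlled by the `L²`-norm of its
gradient over `S`. -/
theorem stmt_6 (d k : ℕ) (hd : 2 ≤ d) (θ L R : ℝ) (hθ0 : 0 < θ) (hθ1 : θ ≤ 1)
    (hL : 0 ≤ L) (hR : 0 ≤ R) :
    ∃ C : ℝ, 0 < C ∧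
      ∀ h : ℝ, 0 < h → ∀ a b : EuclideanSpace ℝ (Fin d),
        sInf (Set.image2 dist
            {y : EuclideanSpace ℝ (Fin d) | ∀ i, y i ∈ Set.Icc (a i) (a i + h)}
            {y : EuclideanSpace ℝ (Fin d) | ∀ i, y i ∈ Set.Icc (b i) (b i + h)}) ≤ R * h →
        ∀ S : Set (EuclideanSpace ℝ (Fin d)), MeasurableSet S →
          S ⊆ {y : EuclideanSpace ℝ (Fin d) | ∀ i, y i ∈ Set.Icc (b i) (b i + h)} →
          ENNReal.ofReal (θ * h ^ d) ≤ volume S →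
          ∀ f : EuclideanSpace ℝ (Fin (d - 1)) → ℝ,
            (∀ x y : EuclideanSpace ℝ (Fin (d - 1)), |f x - f y| ≤ L * dist x y) →
            ∀ p : MvPolynomial (Fin d) ℝ, (∀ i, p.degreeOf i ≤ k + 1) →
              h *
                  ∫ y in
                      ({y : EuclideanSpace ℝ (Fin d) |
                          ∃ x : EuclideanSpace ℝ (Fin (d - 1)),
                            (∀ i : Fin (d - 1), y (Fin.castLE (Nat.sub_le d 1) i) = x i) ∧
                            y ⟨d - 1, by omega⟩ = f x} ∩
                        {y : EuclideanSpace ℝ (Fin d) | ∀ i, y i ∈ Set.Icc (a i) (a i + h)}),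
                    (∑ j, (MvPolynomial.eval (fun i => y i) (MvPolynomial.pderiv j p)) ^ 2)
                    ∂(μH[(d : ℝ) - 1])
                ≤ C * ∫ y in S,
                    ∑ j, (MvPolynomial.eval (fun i => y i) (MvPolynomial.pderiv j p)) ^ 2 := by
  obtain ⟨m, rfl⟩ : ∃ m, d = m + 1 := ⟨d - 1, by omega⟩
  obtain ⟨c, hc, Hc⟩ := exists_sq_eval_le_setIntegral (m + 1) ((m + 1) * (k + 1))
    (M := R + 3) (by linarith) hθ0
  obtain ⟨c', hc', Hc'⟩ := exists_hausdorffMeasure_lipschitz_graph_le m hL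
  refine ⟨c' / c, by positivity, fun h hh a b hab S hS hSb hSθ f hf p hp => ?_⟩
  have hdeg : p.totalDegree ≤ (m + 1) * (k + 1) :=
    p.totalDegree_le_sum_degreeOf.trans
      ((Finset.sum_le_sum fun i _ => hp i).trans (by simp))
  have hpt : ∀ y : EuclideanSpace ℝ (Fin (m + 1)), (∀ i, y i ∈ Set.Icc (a i) (a i + h)) →
      ∀ i, |y i - b i| ≤ (R + 3) * h := by
    intro y hy i
    have hne : (Set.image2 dist
        {y : EuclideanSpace ℝ (Fin (m + 1)) | ∀ i, y i ∈ Set.Icc (a i) (a i + h)}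
        {y : EuclideanSpace ℝ (Fin (m + 1)) | ∀ i, y i ∈ Set.Icc (b i) (b i + h)}).Nonempty :=
      ⟨_, a, fun i => ⟨le_rfl, by linarith⟩, b, fun i => ⟨le_rfl, by linarith⟩, rfl⟩
    obtain ⟨_, ⟨u, hu, v, hv, rfl⟩, huv⟩ :=
      exists_lt_of_csInf_lt hne (hab.trans_lt (by linarith : R * h < (R + 1) * h))
    have hi : |u i - v i| ≤ dist u v := by
      rw [dist_eq_norm]
      exact PiLp.norm_apply_le (u - v) i
    have h1 := abs_le.mp (hi.trans huv.le)
    have h2 := hu i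
    have h3 := hv i
    have h4 := hy i
    simp only [Set.mem_Icc] at h2 h3 h4
    rw [abs_le]
    constructor <;> linarith
  set I := ∫ y in S, ∑ j, (MvPolynomial.eval (fun i => y i) (MvPolynomial.pderiv j p)) ^ 2 with hI
  have hbound : ∀ y : EuclideanSpace ℝ (Fin (m + 1)), (∀ i, y i ∈ Set.Icc (a i) (a i + h)) →
      ∑ j, (MvPolynomial.eval (fun i => y i) (MvPolynomial.pderiv j p)) ^ 2
        ≤ I / (c * h ^ (m + 1)) := by
    intro y hy
    rw [le_div_iff₀' (by positivity), hI,
      integral_finsetSum _ fun j _ => integrableOn_sq_eval _ hSb, Finset.mul_sum]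
    exact Finset.sum_le_sum fun j _ => Hc _ ((MvPolynomial.totalDegree_pderiv_le j p).trans hdeg)
      h hh b y (hpt y hy) S hS hSb hSθ
  have hI0 : 0 ≤ I := integral_nonneg fun y => Finset.sum_nonneg fun j _ => sq_nonneg _
  have hdim : ((m + 1 : ℕ) : ℝ) - 1 = (m : ℝ) := by push_cast; ring
  rw [hdim]
  have hH := Hc' h hh a f hf
  have hnorm := norm_setIntegral_le_of_norm_le_const (hH.trans_lt ENNReal.ofReal_lt_top)
    (f := fun y : EuclideanSpace ℝ (Fin (m + 1)) =>
      ∑ j, (MvPolynomial.eval (fun i => y i) (MvPolynomial.pderiv j p)) ^ 2)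
    (C := I / (c * h ^ (m + 1))) fun y hy => by
      rw [Real.norm_of_nonneg (Finset.sum_nonneg fun j _ => sq_nonneg _)]
      exact hbound y hy.2
  calc _ ≤ h * (I / (c * h ^ (m + 1)) * (c' * h ^ m)) := by
        refine mul_le_mul_of_nonneg_left ((le_abs_self _).trans (hnorm.trans ?_)) hh.le
        exact mul_le_mul_of_nonneg_left (ENNReal.toReal_le_of_le_ofReal (by positivity) hH)
          (by positivity)
    _ = c' / c * I := by field_simp; ring
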